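/- There exist a constant c > 0 and n₀ such that for every n ≥ n₀ there exist a unit vector ψ ∈ ℂ^({0,1}^n) and unit vectors ψ¹, …, ψ^N ∈ ℂ^({0,1}^n) with N = ⌊2^{10^{-10}·n}⌋, such that, writing ρ for the density operator ρ := (1/N)·Σ_{s=1}^N ψ^s(ψ^s)†: (i) ⟨ψ, ρψ⟩ ≤ 2^{−c·n}; and (ii) for every ⌊10^{-8}·n⌋-adaptive orthonormal basis (φ_x)_{x ∈ {0,1}^n} of ℂ^({0,1}^n), Σ_{x ∈ {0,1}^n} | |⟨φ_x, ψ⟩|² − ⟨φ_x, ρ φ_x⟩ | ≤ 2^{−c·n}. (Thus the pure target state ψ and the far-away mixed state ρ induce outcome distributions of exponentially small total variation distance under every single-copy measurement in a ⌊10^{-8}n⌋-adaptive basis; this is the single-copy core of the exponential lower bound for low-adaptivity certification algorithms.) -/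

import Mathlib

open ComplexConjugate

/-- An ℓ-adaptive orthonormal basis of ℂ^({0,1}^n): an orthonormal basis (φ_x) such that
for some S ⊆ [n] with |S| ≤ ℓ, the qubits outside S are measured in fixed single-qubit
bases and the qubits in S in an arbitrary basis depending on the outcomes outside S. -/
def IsAdaptiveBasis (n ℓ : ℕ) (φ : (Fin n → Fin 2) → (Fin n → Fin 2) → ℂ) : Prop :=
  (∀ x x', ∑ y, conj (φ x y) * φ x' y = if x = x' then 1 else 0) ∧
  ∃ S : Finset (Fin n), S.card ≤ ℓ ∧
    ∃ (q : Fin n → Fin 2 → Fin 2 → ℂ)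
      (g : ({i : Fin n // i ∉ S} → Fin 2) → ({i : Fin n // i ∈ S} → Fin 2) →
        ({i : Fin n // i ∈ S} → Fin 2) → ℂ),
      (∀ i, i ∉ S → ∀ a b, ∑ j, conj (q i a j) * q i b j = if a = b then 1 else 0) ∧
      (∀ w z z', ∑ u, conj (g w z u) * g w z' u = if z = z' then 1 else 0) ∧
      (∀ x y, φ x y =
        (∏ i : {i : Fin n // i ∉ S}, q i.val (x i.val) (y i.val)) *
          g (fun i => x i.val) (fun i => x i.val) (fun i => y i.val))

/-- N = ⌊2^{10⁻¹⁰·n}⌋. -/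
noncomputable def NN (n : ℕ) : ℕ := Nat.floor ((2 : ℝ) ^ ((10 : ℝ) ^ (-10 : ℝ) * n))

lemma ite_one_zero_congr {p q : Prop} {_ : Decidable p} {_ : Decidable q} (h : p ↔ q) :
    (if p then (1 : ℂ) else 0) = if q then 1 else 0 :=
  if_congr h rfl rfl

/-- The Hermitian inner product on functions, conjugate-linear in the first argument. -/
def hdot {X : Type*} [Fintype X] (u v : X → ℂ) : ℂ := ∑ y, conj (u y) * v y

open Classical in
/-- A family of functions which is orthonormal for `hdot`. -/
def IsOrthoFamily {I X : Type*} [Fintype X] (φ : I → X → ℂ) : Prop :=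
  ∀ i j, hdot (φ i) (φ j) = if i = j then 1 else 0

lemma hdot_self {X : Type*} [Fintype X] (u : X → ℂ) :
    hdot u u = ((∑ y, ‖u y‖ ^ 2 : ℝ) : ℂ) := by
  simp [hdot, Complex.conj_mul']

lemma IsOrthoFamily.sum_norm_sq {I X : Type*} [Fintype X] {φ : I → X → ℂ}
    (h : IsOrthoFamily φ) (i : I) : ∑ y, ‖φ i y‖ ^ 2 = 1 := by
  have h1 := h i i
  rw [hdot_self, if_pos rfl] at h1
  exact_mod_cast h1

/-- Bessel's inequality. -/
lemma IsOrthoFamily.bessel {I X : Type*} [Fintype X] [Fintype I]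
    {φ : I → X → ℂ} (h : IsOrthoFamily φ) (v : X → ℂ) :
    ∑ i, ‖hdot (φ i) v‖ ^ 2 ≤ ∑ y, ‖v y‖ ^ 2 := by
  have key : ∀ u v : X → ℂ, inner ℂ (WithLp.toLp 2 u) (WithLp.toLp 2 v) = hdot u v := by
    intro u v
    simp [PiLp.inner_apply, hdot, mul_comm]
  have ho : Orthonormal ℂ (fun i => (WithLp.toLp 2 (φ i) : EuclideanSpace ℂ X)) := by
    classical
    rw [orthonormal_iff_ite]
    intro i j
    rw [key, h i j]
  have := ho.sum_inner_products_le (WithLp.toLp 2 v) (s := Finset.univ)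
  simpa [key, EuclideanSpace.norm_sq_eq] using this

lemma IsOrthoFamily.sum_mul_le_one {I X : Type*} [Fintype X] [Fintype I]
    {φ : I → X → ℂ} (h : IsOrthoFamily φ) {u v : X → ℂ} (hu : ∑ y, ‖u y‖ ^ 2 ≤ 1)
    (hv : ∑ y, ‖v y‖ ^ 2 ≤ 1) :
    ∑ i, ‖hdot (φ i) u‖ * ‖hdot (φ i) v‖ ≤ 1 := by
  have h1 := (h.bessel u).trans hu
  have h2 := (h.bessel v).trans hv
  have h3 : ∑ i, ‖hdot (φ i) u‖ * ‖hdot (φ i) v‖ ≤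
      ∑ i, (‖hdot (φ i) u‖ ^ 2 + ‖hdot (φ i) v‖ ^ 2) / 2 := by
    refine Finset.sum_le_sum fun i _ => ?_
    nlinarith [sq_nonneg (‖hdot (φ i) u‖ - ‖hdot (φ i) v‖)]
  rw [← Finset.sum_div, Finset.sum_add_distrib] at h3
  linarith

lemma hdot_pi {κ X : Type*} [Fintype κ] [DecidableEq κ] [Fintype X] (u v : κ → X → ℂ) :
    hdot (fun y : κ → X => ∏ b, u b (y b)) (fun y => ∏ b, v b (y b)) = ∏ b, hdot (u b) (v b) := by
  simp only [hdot, map_prod, ← Finset.prod_mul_distrib]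
  exact (Fintype.prod_sum (fun b y => conj (u b y) * v b y)).symm

lemma hdot_prod {W Z : Type*} [Fintype W] [Fintype Z] (u u' : W → ℂ) (v v' : Z → ℂ) :
    hdot (fun p : W × Z => u p.1 * v p.2) (fun p => u' p.1 * v' p.2) = hdot u u' * hdot v v' := by
  simp only [hdot, map_mul, Fintype.sum_prod_type, Finset.sum_mul_sum]
  refine Finset.sum_congr rfl fun _ _ => Finset.sum_congr rfl fun _ _ => by ring

lemma hdot_equiv {X Y : Type*} [Fintype X] [Fintype Y] (e : X ≃ Y) (u v : Y → ℂ) :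
    hdot (fun x => u (e x)) (fun x => v (e x)) = hdot u v :=
  e.sum_comp (fun y => conj (u y) * v y)

lemma isOrthoFamily_pi {κ I X : Type*} [Fintype κ] [DecidableEq κ] [Fintype X]
    {a : κ → I → X → ℂ} (h : ∀ b, IsOrthoFamily (a b)) :
    IsOrthoFamily (fun (w : κ → I) (y : κ → X) => ∏ b, a b (w b) (y b)) := by
  intro w w'
  rw [hdot_pi (fun b => a b (w b)) (fun b => a b (w' b))]
  simp only [h _ _ _]
  by_cases hw : w = w'
  · simp [hw]
  · rw [if_neg hw]
    obtain ⟨b, hb⟩ := Function.ne_iff.mp hw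
    exact Finset.prod_eq_zero (Finset.mem_univ b) (if_neg hb)

/-- Measuring `W` first and then `Z` adaptively: the overlap of two product vectors is bounded by
the overlap of the outcome distributions on `W`. -/
lemma sum_overlap_le_of_adaptive {W Z : Type*} [Fintype W] [Fintype Z]
    {φ : W × Z → W × Z → ℂ} (hφ : IsOrthoFamily φ)
    {A : W → W → ℂ} (hA : IsOrthoFamily A) {G : W → Z → Z → ℂ}
    (hAG : ∀ p p', φ p p' = A p.1 p'.1 * G p.1 p.2 p'.2) (u u' : W → ℂ) {v v' : Z → ℂ}
    (hv : ∑ z, ‖v z‖ ^ 2 ≤ 1) (hv' : ∑ z, ‖v' z‖ ^ 2 ≤ 1) :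
    ∑ p, ‖hdot (φ p) (fun p => u p.1 * v p.2)‖ * ‖hdot (φ p) (fun p => u' p.1 * v' p.2)‖ ≤
      ∑ w, ‖hdot (A w) u‖ * ‖hdot (A w) u'‖ := by
  have hφ' : ∀ p, φ p = fun p' => A p.1 p'.1 * G p.1 p.2 p'.2 := fun p => funext (hAG p)
  have hG : ∀ w, IsOrthoFamily (G w) := by
    intro w z z'
    have h1 := hφ (w, z) (w, z')
    rw [hφ', hφ', hdot_prod, hA w w, if_pos rfl, one_mul] at h1
    exact h1.trans (ite_one_zero_congr (by simp))
  rw [Fintype.sum_prod_type]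
  refine Finset.sum_le_sum fun w _ => ?_
  calc ∑ z, ‖hdot (φ (w, z)) (fun p => u p.1 * v p.2)‖ *
        ‖hdot (φ (w, z)) (fun p => u' p.1 * v' p.2)‖
      = ‖hdot (A w) u‖ * ‖hdot (A w) u'‖ * ∑ z, ‖hdot (G w z) v‖ * ‖hdot (G w z) v'‖ := by
        rw [Finset.mul_sum]
        refine Finset.sum_congr rfl fun z _ => ?_
        rw [hφ', hdot_prod, hdot_prod, norm_mul, norm_mul]
        ring
    _ ≤ ‖hdot (A w) u‖ * ‖hdot (A w) u'‖ * 1 := by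
        gcongr
        exact (hG w).sum_mul_le_one hv hv'
    _ = _ := mul_one _

lemma sum_overlap_pi {κ I X : Type*} [Fintype κ] [DecidableEq κ] [Fintype X] [Fintype I]
    (a : κ → I → X → ℂ) (u v : κ → X → ℂ) :
    ∑ w : κ → I, ‖hdot (fun y : κ → X => ∏ b, a b (w b) (y b)) (fun y => ∏ b, u b (y b))‖ *
        ‖hdot (fun y : κ → X => ∏ b, a b (w b) (y b)) (fun y => ∏ b, v b (y b))‖ =
      ∏ b, ∑ c, ‖hdot (a b c) (u b)‖ * ‖hdot (a b c) (v b)‖ := by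
  rw [Fintype.prod_sum]
  refine Finset.sum_congr rfl fun w _ => ?_
  rw [hdot_pi (fun b => a b (w b)) u, hdot_pi (fun b => a b (w b)) v, norm_prod, norm_prod,
    Finset.prod_mul_distrib]

/-- Greedy construction of a binary code of minimum distance `d`. -/
lemma exists_code (m d N : ℕ) (h : (N : ℝ) * ((3 / 2) ^ m * 2 ^ d) < 2 ^ m) :
    ∃ s : Fin N → Fin m → Fin 2, ∀ i j, i ≠ j → d ≤ hammingDist (s i) (s j) := by
  induction N with
  | zero => exact ⟨fun i => i.elim0, fun i => i.elim0⟩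
  | succ N ih =>
    have hpos : (0 : ℝ) < (3 / 2) ^ m * 2 ^ d := by positivity
    have h' : (N : ℝ) * ((3 / 2) ^ m * 2 ^ d) < 2 ^ m := by
      push_cast at h
      linarith
    obtain ⟨s, hs⟩ := ih h'
    have hball : ∀ c : Fin m → Fin 2, ∑ y : Fin m → Fin 2, ((1 : ℝ) / 2) ^ hammingDist y c =
        (3 / 2) ^ m := by
      intro c
      have h1 : ∀ y : Fin m → Fin 2, ((1 : ℝ) / 2) ^ hammingDist y c =
          ∏ b, if y b ≠ c b then (1 / 2 : ℝ) else 1 := by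
        intro y
        rw [Finset.prod_ite]
        simp [hammingDist]
      simp only [h1]
      rw [← Fintype.prod_sum (fun b (a : Fin 2) => if a ≠ c b then (1 / 2 : ℝ) else 1)]
      have h2 : ∀ e : Fin 2, ∑ a : Fin 2, (if a ≠ e then (1 / 2 : ℝ) else 1) = 3 / 2 := by
        intro e
        fin_cases e <;> norm_num [Fin.sum_univ_two]
      rw [Finset.prod_congr rfl (fun b _ => h2 (c b))]
      simp [div_pow]
    obtain ⟨y, hy⟩ : ∃ y : Fin m → Fin 2, ∀ i, d ≤ hammingDist y (s i) := by
      by_contra! hcon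
      have h3 : ∑ y : Fin m → Fin 2, ((1 : ℝ) / 2) ^ d ≤
          ∑ y : Fin m → Fin 2, ∑ i, ((1 : ℝ) / 2) ^ hammingDist y (s i) := by
        refine Finset.sum_le_sum fun y _ => ?_
        obtain ⟨i, hi⟩ := hcon y
        calc ((1 : ℝ) / 2) ^ d ≤ (1 / 2) ^ hammingDist y (s i) :=
              pow_le_pow_of_le_one (by norm_num) (by norm_num) hi.le
          _ ≤ _ := Finset.single_le_sum
              (f := fun i => ((1 : ℝ) / 2) ^ hammingDist y (s i))
              (fun i _ => by positivity) (Finset.mem_univ i)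
      rw [Finset.sum_comm] at h3
      simp only [hball] at h3
      simp only [Finset.sum_const, Finset.card_univ, Fintype.card_pi, Fintype.card_fin,
        Finset.prod_const, nsmul_eq_mul, Nat.cast_pow, Nat.cast_ofNat] at h3
      have h4 : (2 : ℝ) ^ m * (1 / 2) ^ d * 2 ^ d ≤ N * (3 / 2) ^ m * 2 ^ d := by gcongr
      have h5 : ((1 : ℝ) / 2) ^ d * 2 ^ d = 1 := by rw [← mul_pow]; norm_num
      rw [mul_assoc, h5] at h4
      linarith
    refine ⟨Fin.cons y s, ?_⟩
    intro i j hij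
    induction i using Fin.cases with
    | zero =>
      induction j using Fin.cases with
      | zero => exact absurd rfl hij
      | succ j => simpa using hy j
    | succ i =>
      induction j using Fin.cases with
      | zero => simpa [hammingDist_comm] using hy i
      | succ j => simpa using hs i j (fun h => hij (by rw [h]))

lemma gram_contradiction {p x y : Fin 3 → ℝ} (h0 : ∀ i, 0 ≤ p i) (h1 : ∀ i, p i ≤ 1)
    (hxy : ∀ i, x i ^ 2 + y i ^ 2 = p i * (1 - p i)) (hs : ∀ i, |1 - 2 * p i| ≤ 1 / 20)
    (hp : ∀ i j, i ≠ j →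
      |p i + p j - 4 * (p i * p j) + 2 * (x i * x j + y i * y j)| ≤ 1 / 20) : False := by
  have hg : ∀ i j, i ≠ j → (x i * x j + y i * y j) ^ 2 ≤ (3 / 40) ^ 2 := by
    intro i j hij
    have a := abs_le.mp (hs i)
    have b := abs_le.mp (hs j)
    have c := abs_le.mp (hp i j hij)
    have := h0 i
    have := h0 j
    have := h1 i
    have := h1 j
    apply sq_le_sq'
    · nlinarith
    · nlinarith
  have hd : ∀ i, 399 / 1600 ≤ x i ^ 2 + y i ^ 2 ∧ x i ^ 2 + y i ^ 2 ≤ 1 / 4 := by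
    intro i
    rw [hxy]
    have a := abs_le.mp (hs i)
    constructor
    · nlinarith
    · nlinarith [sq_nonneg (1 - 2 * p i)]
  have det : (x 0 ^ 2 + y 0 ^ 2) * (x 1 ^ 2 + y 1 ^ 2) * (x 2 ^ 2 + y 2 ^ 2)
      + 2 * (x 0 * x 1 + y 0 * y 1) * (x 0 * x 2 + y 0 * y 2) * (x 1 * x 2 + y 1 * y 2)
      = (x 0 ^ 2 + y 0 ^ 2) * (x 1 * x 2 + y 1 * y 2) ^ 2
      + (x 1 ^ 2 + y 1 ^ 2) * (x 0 * x 2 + y 0 * y 2) ^ 2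
      + (x 2 ^ 2 + y 2 ^ 2) * (x 0 * x 1 + y 0 * y 1) ^ 2 := by ring
  have g01 := hg 0 1 (by decide)
  have g02 := hg 0 2 (by decide)
  have g12 := hg 1 2 (by decide)
  have d0 := hd 0
  have d1 := hd 1
  have d2 := hd 2
  generalize x 0 ^ 2 + y 0 ^ 2 = D0 at *
  generalize x 1 ^ 2 + y 1 ^ 2 = D1 at *
  generalize x 2 ^ 2 + y 2 ^ 2 = D2 at *
  generalize x 0 * x 1 + y 0 * y 1 = A at *
  generalize x 0 * x 2 + y 0 * y 2 = B at *
  generalize x 1 * x 2 + y 1 * y 2 = C at *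
  have e1 : D0 * C ^ 2 ≤ 1 / 4 * (3 / 40) ^ 2 := by gcongr; exact d0.2
  have e2 : D1 * B ^ 2 ≤ 1 / 4 * (3 / 40) ^ 2 := by gcongr; exact d1.2
  have e3 : D2 * A ^ 2 ≤ 1 / 4 * (3 / 40) ^ 2 := by gcongr; exact d2.2
  have e4 : (399 / 1600 : ℝ) * (399 / 1600) * (399 / 1600) ≤ D0 * D1 * D2 := by
    have := d0.1
    have := d1.1
    have := d2.1
    have : 0 ≤ D0 := by linarith
    have : 0 ≤ D1 := by linarith
    gcongr
  have aA := abs_le_of_sq_le_sq g01 (by norm_num)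
  have aB := abs_le_of_sq_le_sq g02 (by norm_num)
  have aC := abs_le_of_sq_le_sq g12 (by norm_num)
  have e5 : |A * B * C| ≤ 3 / 40 * (3 / 40) * (3 / 40) := by
    rw [abs_mul, abs_mul]; gcongr
  have := abs_le.mp e5
  nlinarith

/-- The three-qubit block states: `|000⟩` and the W state. -/
noncomputable def blockState (a : Fin 2) (y : Fin 3 → Fin 2) : ℂ :=
  if a = 0 then (if y = 0 then 1 else 0)
  else (Real.sqrt 3 : ℂ)⁻¹ * ∑ j, if y = Pi.single j 1 then 1 else 0

lemma sum_fin_three_fin_two {M : Type*} [AddCommMonoid M] (F : (Fin 3 → Fin 2) → M) :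
    ∑ c, F c = ∑ a, ∑ b, ∑ d, F ![a, b, d] := by
  have h : (Finset.univ : Finset (Fin 3 → Fin 2)) =
      {![0, 0, 0], ![0, 0, 1], ![0, 1, 0], ![0, 1, 1],
        ![1, 0, 0], ![1, 0, 1], ![1, 1, 0], ![1, 1, 1]} := by decide
  rw [h]
  repeat rw [Finset.sum_insert (by decide)]
  simp only [Finset.sum_singleton, Fin.sum_univ_two, add_assoc]

lemma sqrt_three_inv_mul : ((Real.sqrt 3 : ℂ)⁻¹) * (Real.sqrt 3 : ℂ)⁻¹ * 3 = 1 := by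
  have h : ((Real.sqrt 3 : ℂ)) * (Real.sqrt 3 : ℂ) = 3 := by
    rw [← Complex.ofReal_mul, Real.mul_self_sqrt (by norm_num)]
    norm_num
  have h0 : (Real.sqrt 3 : ℂ) ≠ 0 := by
    intro h'
    rw [h'] at h
    norm_num at h
  field_simp
  rw [sq, h]

lemma isOrthoFamily_blockState : IsOrthoFamily blockState := by
  intro a b
  have h := sqrt_three_inv_mul
  simp only [hdot, sum_fin_three_fin_two, Fin.sum_univ_two, blockState, Fin.sum_univ_three]
  fin_cases a <;> fin_cases b <;>
    simp +decide [-mul_inv_rev]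
  linear_combination h

lemma hdot_blockState_zero (f : (Fin 3 → Fin 2) → ℂ) : hdot f (blockState 0) = conj (f 0) := by
  simp [hdot, blockState]

lemma hdot_blockState_one (f : (Fin 3 → Fin 2) → ℂ) :
    hdot f (blockState 1) = (Real.sqrt 3 : ℂ)⁻¹ * ∑ j, conj (f (Pi.single j 1)) := by
  simp only [hdot, blockState, one_ne_zero, if_false]
  simp only [Finset.mul_sum, mul_ite, mul_one, mul_zero]
  rw [Finset.sum_comm]
  simp [mul_comm]

lemma sum_norm_sq_isometry {α β : Fin 2 → ℂ} (hα : ∑ a, ‖α a‖ ^ 2 = 1)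
    (hβ : ∑ a, ‖β a‖ ^ 2 = 1) (hαβ : ∑ a, α a * conj (β a) = 0) (X Y : ℂ) :
    ∑ a, ‖X * α a + Y * β a‖ ^ 2 = ‖X‖ ^ 2 + ‖Y‖ ^ 2 := by
  simp only [← Complex.normSq_eq_norm_sq, Complex.normSq_apply, Fin.sum_univ_two] at *
  have h1 := congrArg Complex.re hαβ
  have h2 := congrArg Complex.im hαβ
  simp at *
  linear_combination (X.re * X.re + X.im * X.im) * hα + (Y.re * Y.re + Y.im * Y.im) * hβ +
    2 * (X.re * Y.re + X.im * Y.im) * h1 - 2 * (X.im * Y.re - X.re * Y.im) * h2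

lemma sum_col_of_row {q : Fin 2 → Fin 2 → ℂ} (hq : IsOrthoFamily q) (k l : Fin 2) :
    ∑ a, conj (q a k) * q a l = if k = l then 1 else 0 := by
  have h1 : Matrix.of q * (Matrix.of q).conjTranspose = 1 := by
    ext a b
    rw [Matrix.mul_apply, Matrix.one_apply]
    exact (Finset.sum_congr rfl fun _ _ => mul_comm _ _).trans
      ((hq b a).trans (ite_one_zero_congr eq_comm))
  have h2 : ((Matrix.of q).conjTranspose * Matrix.of q) k l = (1 : Matrix (Fin 2) (Fin 2) ℂ) k l :=
    congrArg (fun M : Matrix (Fin 2) (Fin 2) ℂ => M k l) (mul_eq_one_comm.mp h1)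
  simpa [Matrix.mul_apply, Matrix.one_apply] using h2

/-- Three times the difference of the outcome probabilities of the W state and of `|000⟩`, where
`a`, `b` and so on are the conjugated coordinates of the three single-qubit vectors. -/
noncomputable def wGap (a b a' b' a'' b'' : ℂ) : ℝ :=
  ‖b * a' * a'' + a * b' * a'' + a * a' * b''‖ ^ 2 - 3 * ‖a * a' * a''‖ ^ 2

lemma wGap_swap_left (a b a' b' a'' b'' : ℂ) :
    wGap a b a' b' a'' b'' = wGap a' b' a b a'' b'' := by
  unfold wGap
  rw [show b * a' * a'' + a * b' * a'' + a * a' * b'' =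
    b' * a * a'' + a' * b * a'' + a' * a * b'' by ring, mul_comm a a']

lemma wGap_swap_right (a b a' b' a'' b'' : ℂ) :
    wGap a b a' b' a'' b'' = wGap a b a'' b'' a' b' := by
  unfold wGap
  rw [show b * a' * a'' + a * b' * a'' + a * a' * b'' =
    b * a'' * a' + a * b'' * a' + a * a'' * b' by ring, mul_right_comm a a' a'']

lemma sum_wGap {α β : Fin 2 → ℂ} (hα : ∑ a, ‖α a‖ ^ 2 = 1)
    (hβ : ∑ a, ‖β a‖ ^ 2 = 1) (hαβ : ∑ a, α a * conj (β a) = 0) (a b a' b' : ℂ) :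
    ∑ d, wGap a b a' b' (α d) (β d) = ‖b * a' + a * b'‖ ^ 2 - 2 * ‖a * a'‖ ^ 2 := by
  have h1 := sum_norm_sq_isometry hα hβ hαβ (b * a' + a * b') (a * a')
  have h2 : ∑ d, ‖a * a' * α d‖ ^ 2 = ‖a * a'‖ ^ 2 := by
    simp only [norm_mul _ (α _), mul_pow, ← Finset.mul_sum, hα, mul_one]
  simp only [wGap, Finset.sum_sub_distrib, ← Finset.mul_sum, h2, ← add_mul (b * a'), h1]
  ring

lemma sum_sum_wGap {α β α' β' : Fin 2 → ℂ} (hα : ∑ a, ‖α a‖ ^ 2 = 1)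
    (hβ : ∑ a, ‖β a‖ ^ 2 = 1) (hαβ : ∑ a, α a * conj (β a) = 0)
    (hα' : ∑ a, ‖α' a‖ ^ 2 = 1) (hβ' : ∑ a, ‖β' a‖ ^ 2 = 1)
    (hαβ' : ∑ a, α' a * conj (β' a) = 0) {a b : ℂ} (hab : ‖a‖ ^ 2 + ‖b‖ ^ 2 = 1) :
    ∑ c, ∑ d, wGap a b (α c) (β c) (α' d) (β' d) = 1 - 2 * ‖a‖ ^ 2 := by
  have h1 := sum_norm_sq_isometry hα hβ hαβ b a
  have h2 : ∑ d, ‖a * α d‖ ^ 2 = ‖a‖ ^ 2 := by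
    simp only [norm_mul _ (α _), mul_pow, ← Finset.mul_sum, hα, mul_one]
  simp only [sum_wGap hα' hβ' hαβ', Finset.sum_sub_distrib, ← Finset.mul_sum, h1, h2]
  linarith

lemma pair_gap_eq {a b a' b' : ℂ} (h : ‖a‖ ^ 2 + ‖b‖ ^ 2 = 1) (h' : ‖a'‖ ^ 2 + ‖b'‖ ^ 2 = 1) :
    ‖b * a' + a * b'‖ ^ 2 - 2 * ‖a * a'‖ ^ 2 =
      ‖a‖ ^ 2 + ‖a'‖ ^ 2 - 4 * (‖a‖ ^ 2 * ‖a'‖ ^ 2) +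
        2 * ((b * conj a).re * (b' * conj a').re + (b * conj a).im * (b' * conj a').im) := by
  simp only [← Complex.normSq_eq_norm_sq, Complex.normSq_apply] at *
  simp
  linear_combination (a.re * a.re + a.im * a.im) * h' + (a'.re * a'.re + a'.im * a'.im) * h

/-- In every product basis the outcome distributions of the two block states are far apart. -/
lemma blockState_overlap {q : Fin 3 → Fin 2 → Fin 2 → ℂ} (hq : ∀ j, IsOrthoFamily (q j)) :
    ∑ c : Fin 3 → Fin 2, ‖hdot (fun y => ∏ j, q j (c j) (y j)) (blockState 0)‖ *
      ‖hdot (fun y => ∏ j, q j (c j) (y j)) (blockState 1)‖ ≤ 1 - 1 / 30000 := by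
  have hpi : IsOrthoFamily (fun (c : Fin 3 → Fin 2) (y : Fin 3 → Fin 2) => ∏ j, q j (c j) (y j)) :=
    isOrthoFamily_pi hq
  have hu1 := (hpi.bessel (blockState 0)).trans_eq (isOrthoFamily_blockState.sum_norm_sq 0)
  have hv1 := (hpi.bessel (blockState 1)).trans_eq (isOrthoFamily_blockState.sum_norm_sq 1)
  set α : Fin 3 → Fin 2 → ℂ := fun j a => conj (q j a 0) with hαdef
  set β : Fin 3 → Fin 2 → ℂ := fun j a => conj (q j a 1) with hβdef
  set u : (Fin 3 → Fin 2) → ℝ :=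
    fun c => ‖hdot (fun y => ∏ j, q j (c j) (y j)) (blockState 0)‖ with hu
  set v : (Fin 3 → Fin 2) → ℝ :=
    fun c => ‖hdot (fun y => ∏ j, q j (c j) (y j)) (blockState 1)‖ with hv
  change ∑ c, u c * v c ≤ _
  change ∑ c, u c ^ 2 ≤ 1 at hu1
  change ∑ c, v c ^ 2 ≤ 1 at hv1
  have hcol : ∀ j, (∑ a, ‖α j a‖ ^ 2 = 1) ∧ (∑ a, ‖β j a‖ ^ 2 = 1) ∧
      ∑ a, α j a * conj (β j a) = 0 := by
    intro j
    have e0 := sum_col_of_row (hq j) 0 0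
    have e1 := sum_col_of_row (hq j) 1 1
    have e2 := sum_col_of_row (hq j) 0 1
    simp only [Complex.conj_mul', if_true] at e0 e1
    refine ⟨?_, ?_, ?_⟩
    · simp only [hαdef, RCLike.norm_conj]
      exact_mod_cast e0
    · simp only [hβdef, RCLike.norm_conj]
      exact_mod_cast e1
    · simpa [hαdef, hβdef] using e2
  have hrow : ∀ j a, ‖α j a‖ ^ 2 + ‖β j a‖ ^ 2 = 1 := by
    intro j a
    have := (hq j).sum_norm_sq a
    simpa [Fin.sum_univ_two, hαdef, hβdef] using this
  have hgap : ∀ a b d, 3 * (v ![a, b, d] ^ 2 - u ![a, b, d] ^ 2) =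
      wGap (α 0 a) (β 0 a) (α 1 b) (β 1 b) (α 2 d) (β 2 d) := by
    intro a b d
    have hs : ‖(Real.sqrt 3 : ℂ)⁻¹‖ ^ 2 = 1 / 3 := by
      rw [norm_inv, Complex.norm_real, Real.norm_eq_abs, inv_pow, sq_abs,
        Real.sq_sqrt (by norm_num)]
      norm_num
    simp only [hu, hv, hdot_blockState_zero, hdot_blockState_one, norm_mul _ (∑ _, _), mul_pow, hs]
    simp [wGap, hαdef, hβdef, Fin.prod_univ_three, Fin.sum_univ_three]
    ring
  by_contra! hBC
  have hD : ∑ c, |v c ^ 2 - u c ^ 2| ≤ 1 / 60 := by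
    have h1 : (∑ c, |v c - u c| * |v c + u c|) ^ 2 ≤
        (∑ c, |v c - u c| ^ 2) * ∑ c, |v c + u c| ^ 2 := Finset.sum_mul_sq_le_sq_mul_sq _ _ _
    have h2 : ∀ c, |v c - u c| * |v c + u c| = |v c ^ 2 - u c ^ 2| := by
      intro c
      rw [← abs_mul]
      congr 1
      ring
    have h3 : ∑ c, |v c - u c| ^ 2 ≤ 2 - 2 * ∑ c, u c * v c := by
      have : ∑ c, |v c - u c| ^ 2 = ∑ c, u c ^ 2 + ∑ c, v c ^ 2 - 2 * ∑ c, u c * v c := by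
        rw [Finset.mul_sum, ← Finset.sum_add_distrib, ← Finset.sum_sub_distrib]
        refine Finset.sum_congr rfl fun c _ => ?_
        rw [sq_abs]
        ring
      linarith
    have h4 : ∑ c, |v c + u c| ^ 2 ≤ 4 := by
      have : ∑ c, |v c + u c| ^ 2 ≤ 2 * ∑ c, u c ^ 2 + 2 * ∑ c, v c ^ 2 := by
        rw [Finset.mul_sum, Finset.mul_sum, ← Finset.sum_add_distrib]
        refine Finset.sum_le_sum fun c _ => ?_
        rw [sq_abs]
        nlinarith [sq_nonneg (v c - u c)]
      linarith
    simp only [h2] at h1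
    have h5 : (∑ c, |v c - u c| ^ 2) * ∑ c, |v c + u c| ^ 2 ≤ (2 / 30000) * 4 := by
      gcongr
      linarith
    refine abs_le_of_sq_le_sq' ?_ (by norm_num) |>.2
    linarith
  have hW : ∀ P : (Fin 3 → Fin 2) → Prop, [DecidablePred P] →
      |∑ c, if P c then 3 * (v c ^ 2 - u c ^ 2) else 0| ≤ 1 / 20 := by
    intro P _
    calc |∑ c, if P c then 3 * (v c ^ 2 - u c ^ 2) else 0|
        ≤ ∑ c, |if P c then 3 * (v c ^ 2 - u c ^ 2) else 0| := Finset.abs_sum_le_sum_abs _ _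
      _ ≤ ∑ c, 3 * |v c ^ 2 - u c ^ 2| := by
          refine Finset.sum_le_sum fun c _ => ?_
          split_ifs
          · rw [abs_mul]
            norm_num
          · simp
      _ ≤ 1 / 20 := by
          rw [← Finset.mul_sum]
          linarith
  refine gram_contradiction (p := fun i => ‖α i 0‖ ^ 2) (x := fun i => (β i 0 * conj (α i 0)).re)
    (y := fun i => (β i 0 * conj (α i 0)).im) (fun i => by positivity)
    (fun i => by nlinarith [hrow i 0, sq_nonneg ‖β i 0‖]) (fun i => ?_) (fun i => ?_)
    (fun i j hij => ?_)
  · rw [show 1 - ‖α i 0‖ ^ 2 = ‖β i 0‖ ^ 2 by linarith [hrow i 0]]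
    simp only [← Complex.normSq_eq_norm_sq, Complex.normSq_apply]
    simp
    ring
  · have h := hW (fun c => c i = 0)
    rw [sum_fin_three_fin_two] at h
    simp only [hgap] at h
    obtain ⟨a0, b0, c0⟩ := hcol 0
    obtain ⟨a1, b1, c1⟩ := hcol 1
    obtain ⟨a2, b2, c2⟩ := hcol 2
    have s0 := sum_sum_wGap a1 b1 c1 a2 b2 c2 (hrow 0 0)
    have s1 := sum_sum_wGap a0 b0 c0 a2 b2 c2 (hrow 1 0)
    have s2 := sum_sum_wGap a0 b0 c0 a1 b1 c1 (hrow 2 0)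
    simp only [wGap_swap_left (α 1 0)] at s1
    simp only [wGap_swap_left (α 2 0), wGap_swap_right _ _ (α 2 0)] at s2
    fin_cases i <;> simp [Fin.sum_univ_two] at h s0 s1 s2 ⊢
    · rwa [s0] at h
    · rwa [s1] at h
    · rwa [s2] at h
  · rw [← pair_gap_eq (hrow i 0) (hrow j 0)]
    have h := hW (fun c => c i = 0 ∧ c j = 0)
    rw [sum_fin_three_fin_two] at h
    simp only [hgap] at h
    have s (k i j : Fin 3) := sum_wGap (hcol k).1 (hcol k).2.1 (hcol k).2.2 (α i 0) (β i 0)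
      (α j 0) (β j 0)
    have s01 := s 2 0 1
    have s10 := s 2 1 0
    have s02 := s 1 0 2
    have s20 := s 1 2 0
    have s12 := s 0 1 2
    have s21 := s 0 2 1
    simp only [wGap_swap_left (α 1 0)] at s10
    simp only [wGap_swap_left (α 2 0)] at s20 s21
    simp only [wGap_swap_right _ _ (α 2 0)] at s02 s20 s12 s21
    simp only [wGap_swap_left (α 1 0)] at s12 s21
    clear s
    fin_cases i <;> fin_cases j <;>
      simp [Fin.sum_univ_two] at hij h s01 s10 s02 s20 s12 s21 ⊢
    · rwa [s01] at h
    · rwa [s02] at h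
    · rwa [s10] at h
    · rwa [s12] at h
    · rwa [s20] at h
    · rwa [s21] at h

lemma prod_eq_prod_comp_mul {ι κ : Type*} [Fintype ι] [Fintype κ] {h : κ → ι}
    (hh : Function.Injective h) [DecidablePred (· ∈ Set.range h)] (F : ι → ℂ) :
    ∏ i, F i = (∏ k, F (h k)) * ∏ i, if i ∈ Set.range h then 1 else F i := by
  classical
  have h1 : ∏ k, F (h k) = ∏ i, if i ∈ Set.range h then F i else 1 := by
    rw [← Finset.prod_filter, ← Finset.prod_image (s := Finset.univ) (g := h) hh.injOn]
    refine Finset.prod_congr ?_ fun _ _ => rfl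
    ext i
    simp
  rw [h1, ← Finset.prod_mul_distrib]
  refine Finset.prod_congr rfl fun i _ => ?_
  split_ifs <;> simp

/-- Split a configuration into its restriction to the blocks given by `f` and the rest. -/
noncomputable def splitEquiv {ι κ τ X : Type*} {f : κ × τ → ι} (hf : Function.Injective f) :
    (ι → X) ≃ (κ → τ → X) × (↥(Set.range f)ᶜ → X) :=
  Equiv.ofBijective (fun y => (fun b j => y (f (b, j)), fun i => y i)) <| by
    classical
    constructor
    · intro y y' h
      rw [Prod.mk.injEq] at h
      funext i
      by_cases hi : i ∈ Set.range f
      · obtain ⟨⟨b, j⟩, rfl⟩ := hi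
        exact congrFun (congrFun h.1 b) j
      · exact congrFun h.2 ⟨i, hi⟩
    · rintro ⟨w, z⟩
      refine ⟨fun i => if h : i ∈ Set.range f then w h.choose.1 h.choose.2 else z ⟨i, h⟩, ?_⟩
      rw [Prod.mk.injEq]
      constructor
      · funext b j
        have h : f (b, j) ∈ Set.range f := ⟨_, rfl⟩
        have h2 : h.choose = (b, j) := hf h.choose_spec
        simp only [dif_pos h, h2]
      · funext i
        exact dif_neg i.2

lemma splitEquiv_symm_apply_mem {ι κ τ X : Type*} {f : κ × τ → ι} (hf : Function.Injective f)
    (p : (κ → τ → X) × (↥(Set.range f)ᶜ → X)) (b : κ) (j : τ) :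
    (splitEquiv hf).symm p (f (b, j)) = p.1 b j :=
  congrFun (congrFun (congrArg Prod.fst ((splitEquiv hf).apply_symm_apply p)) b) j

lemma splitEquiv_symm_apply_notMem {ι κ τ X : Type*} {f : κ × τ → ι} (hf : Function.Injective f)
    (p : (κ → τ → X) × (↥(Set.range f)ᶜ → X)) {i : ι} (hi : i ∉ Set.range f) :
    (splitEquiv hf).symm p i = p.2 ⟨i, hi⟩ :=
  congrFun (congrArg Prod.snd ((splitEquiv hf).apply_symm_apply p)) ⟨i, hi⟩

open Classical in
/-- The product of the block states selected by the word `s`, with `0` on the leftover qubits. -/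
noncomputable def codeState {n m : ℕ} (pos : Fin m × Fin 3 → Fin n) (s : Fin m → Fin 2)
    (y : Fin n → Fin 2) : ℂ :=
  (∏ b, blockState (s b) (fun j => y (pos (b, j)))) *
    if ∀ i, i ∉ Set.range pos → y i = 0 then 1 else 0

lemma isOrthoFamily_codeState {n m : ℕ} {pos : Fin m × Fin 3 → Fin n}
    (hpos : Function.Injective pos) : IsOrthoFamily (codeState pos) := by
  classical
  intro s t
  let F : (Fin m → Fin 2) → (Fin m → Fin 3 → Fin 2) × (↥(Set.range pos)ᶜ → Fin 2) → ℂ :=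
    fun s p => (∏ b, blockState (s b) (p.1 b)) * if p.2 = 0 then 1 else 0
  have key : ∀ s, codeState pos s = fun y => F s (splitEquiv hpos y) := by
    intro s
    funext y
    have : (∀ i, i ∉ Set.range pos → y i = 0) ↔ (splitEquiv hpos y).2 = 0 := by
      constructor
      · intro h
        funext i
        exact h i i.2
      · intro h i hi
        exact congrFun h ⟨i, hi⟩
    simp only [codeState, this, F]
    rfl
  rw [key, key, hdot_equiv (splitEquiv hpos) (F s) (F t),
    hdot_prod (fun w : Fin m → Fin 3 → Fin 2 => ∏ b, blockState (s b) (w b))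
      (fun w => ∏ b, blockState (t b) (w b)) (fun z => if z = 0 then (1 : ℂ) else 0)
      (fun z => if z = 0 then 1 else 0)]
  have h1 := isOrthoFamily_pi (κ := Fin m) (fun _ => isOrthoFamily_blockState) s t
  rw [h1]
  simp [hdot]

lemma card_touched_le {n m : ℕ} {pos : Fin m × Fin 3 → Fin n} (hpos : Function.Injective pos)
    (S : Finset (Fin n)) :
    (Finset.univ.filter fun b => ¬ ∀ j, pos (b, j) ∉ S).card ≤ S.card := by
  classical
  have h : ∀ b, ∃ j, (¬ ∀ j, pos (b, j) ∉ S) → pos (b, j) ∈ S := by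
    intro b
    by_cases hb : ∀ j, pos (b, j) ∉ S
    · exact ⟨0, fun h => absurd hb h⟩
    · push Not at hb
      obtain ⟨j, hj⟩ := hb
      exact ⟨j, fun _ => hj⟩
  choose j hj using h
  refine Finset.card_le_card_of_injOn (fun b => pos (b, j b)) ?_ ?_
  · intro b hb
    exact hj b (by simpa using hb)
  · intro b _ b' _ hbb
    exact congrArg Prod.fst (hpos hbb)

lemma blockState_overlap_le {q : Fin 3 → Fin 2 → Fin 2 → ℂ} (hq : ∀ j, IsOrthoFamily (q j))
    (a b : Fin 2) :
    ∑ c : Fin 3 → Fin 2, ‖hdot (fun y => ∏ j, q j (c j) (y j)) (blockState a)‖ *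
      ‖hdot (fun y => ∏ j, q j (c j) (y j)) (blockState b)‖ ≤
      if a ≠ b then 1 - 1 / 30000 else 1 := by
  split_ifs with h
  · have h0 := blockState_overlap hq
    fin_cases a <;> fin_cases b
    · exact absurd rfl h
    · exact h0
    · exact (Finset.sum_congr rfl fun c _ => mul_comm _ _).trans_le h0
    · exact absurd rfl h
  · have hpi : IsOrthoFamily
        (fun (c : Fin 3 → Fin 2) (y : Fin 3 → Fin 2) => ∏ j, q j (c j) (y j)) :=
      isOrthoFamily_pi hq
    exact hpi.sum_mul_le_one (isOrthoFamily_blockState.sum_norm_sq a).le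
      (isOrthoFamily_blockState.sum_norm_sq b).le

set_option maxHeartbeats 1000000 in
lemma codeState_overlap_le {n m ℓ : ℕ} {pos : Fin m × Fin 3 → Fin n}
    (hpos : Function.Injective pos) {φ : (Fin n → Fin 2) → (Fin n → Fin 2) → ℂ}
    (hφ : IsAdaptiveBasis n ℓ φ) (s t : Fin m → Fin 2) :
    ∑ x, ‖hdot (φ x) (codeState pos s)‖ * ‖hdot (φ x) (codeState pos t)‖ ≤
      (1 - 1 / 30000 : ℝ) ^ (hammingDist s t - ℓ) := by
  classical
  obtain ⟨hortho, S, hS, q, g, hq, -, hφeq⟩ := hφ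
  let U := {b : Fin m // ∀ j, pos (b, j) ∉ S}
  let f : U × Fin 3 → Fin n := fun k => pos (k.1.1, k.2)
  have hf : Function.Injective f := by
    rintro ⟨b, j⟩ ⟨b', j'⟩ h
    have := hpos h
    rw [Prod.mk.injEq] at this ⊢
    exact ⟨Subtype.ext this.1, this.2⟩
  let e := splitEquiv (X := Fin 2) hf
  have hrest : ∀ (w w' : U → Fin 3 → Fin 2) (z) (i : Fin n), i ∉ Set.range f →
      e.symm (w, z) i = e.symm (w', z) i := by
    intro w w' z i hi
    rw [splitEquiv_symm_apply_notMem hf _ hi, splitEquiv_symm_apply_notMem hf _ hi]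
  have hUf : ∀ b : Fin m, (¬ ∀ j, pos (b, j) ∉ S) → ∀ j, pos (b, j) ∉ Set.range f := by
    rintro b hb j ⟨⟨b', j'⟩, h⟩
    have := hpos h
    rw [Prod.mk.injEq] at this
    exact hb (this.1 ▸ b'.2)
  let φ' := fun p p' => φ (e.symm p) (e.symm p')
  have hφ' : IsOrthoFamily φ' := by
    intro p p'
    rw [hdot_equiv e.symm (φ (e.symm p)) (φ (e.symm p'))]
    refine (hortho (e.symm p) (e.symm p')).trans ?_
    exact ite_one_zero_congr e.symm.injective.eq_iff
  let u : (Fin m → Fin 2) → (U → Fin 3 → Fin 2) → ℂ := fun s w => ∏ b, blockState (s b.1) (w b)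
  let v : (Fin m → Fin 2) → (↥(Set.range f)ᶜ → Fin 2) → ℂ := fun s z =>
    (∏ b : {b : Fin m // ¬ ∀ j, pos (b, j) ∉ S},
      blockState (s b.1) (fun j => e.symm (0, z) (pos (b.1, j)))) *
    if ∀ i, i ∉ Set.range pos → e.symm (0, z) i = 0 then 1 else 0
  have hsplit : ∀ s, (fun p => codeState pos s (e.symm p)) = fun p => u s p.1 * v s p.2 := by
    intro s
    funext p
    obtain ⟨w, z⟩ := p
    have h1 : (∀ i, i ∉ Set.range pos → e.symm (w, z) i = 0) ↔
        ∀ i, i ∉ Set.range pos → e.symm (0, z) i = 0 := by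
      refine forall₂_congr fun i hi => ?_
      rw [hrest w 0 z i]
      rintro ⟨k, rfl⟩
      exact hi ⟨_, rfl⟩
    simp only [codeState, u, v, h1, ← mul_assoc]
    congr 1
    rw [← Fintype.prod_subtype_mul_prod_subtype (fun b => ∀ j, pos (b, j) ∉ S)]
    congr 1
    · refine Finset.prod_congr rfl fun b _ => ?_
      congr 1
      funext j
      exact splitEquiv_symm_apply_mem hf (w, z) b j
    · refine Finset.prod_congr rfl fun b _ => ?_
      congr 1
      funext j
      exact hrest _ _ _ _ (hUf b.1 b.2 j)
  have hv : ∀ s, ∑ z, ‖v s z‖ ^ 2 ≤ 1 := by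
    intro s
    have h1 := isOrthoFamily_codeState hpos s s
    rw [← hdot_equiv e.symm, hsplit s, hdot_prod,
      hdot_pi (fun b : U => blockState (s b.1)) (fun b : U => blockState (s b.1)), if_pos rfl] at h1
    simp only [isOrthoFamily_blockState _ _, if_true, Finset.prod_const_one, one_mul] at h1
    rw [hdot_self] at h1
    exact le_of_eq (by exact_mod_cast h1)
  let a : U → (Fin 3 → Fin 2) → (Fin 3 → Fin 2) → ℂ :=
    fun b c y => ∏ j, q (pos (b.1, j)) (c j) (y j)
  have hqU : ∀ (b : U) j, IsOrthoFamily (q (pos (b.1, j))) := fun b j x y =>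
    (hq _ (b.2 j) x y).trans (ite_one_zero_congr Iff.rfl)
  let A : (U → Fin 3 → Fin 2) → (U → Fin 3 → Fin 2) → ℂ := fun w w' => ∏ b, a b (w b) (w' b)
  have hA : IsOrthoFamily A := isOrthoFamily_pi fun b => isOrthoFamily_pi (hqU b)
  let h : U × Fin 3 → {i : Fin n // i ∉ S} := fun k => ⟨f k, k.1.2 k.2⟩
  have hh : Function.Injective h := fun k k' hk => hf (congrArg Subtype.val hk)
  let G : (U → Fin 3 → Fin 2) → (↥(Set.range f)ᶜ → Fin 2) → (↥(Set.range f)ᶜ → Fin 2) → ℂ :=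
    fun w z z' =>
      (∏ i : {i : Fin n // i ∉ S}, if i ∈ Set.range h then 1 else
        q i.val (e.symm (w, z) i.val) (e.symm (0, z') i.val)) *
      g (fun i => e.symm (w, z) i.val) (fun i => e.symm (w, z) i.val)
        (fun i => e.symm (0, z') i.val)
  have hAG : ∀ p p', φ' p p' = A p.1 p'.1 * G p.1 p.2 p'.2 := by
    rintro ⟨w, z⟩ ⟨w', z'⟩
    simp only [φ', hφeq, A, G, a, ← mul_assoc]
    congr 1
    · rw [prod_eq_prod_comp_mul hh]
      congr 1
      · rw [Fintype.prod_prod_type]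
        refine Finset.prod_congr rfl fun b _ => Finset.prod_congr rfl fun j _ => ?_
        have e1 := splitEquiv_symm_apply_mem hf (w, z) b j
        have e2 := splitEquiv_symm_apply_mem hf (w', z') b j
        exact congrArg₂ (q (pos (b.1, j))) e1 e2
      · refine Finset.prod_congr rfl fun i _ => ?_
        split_ifs with hi
        · rfl
        · congr 1
          refine hrest _ _ _ _ ?_
          rintro ⟨k, hk⟩
          exact hi ⟨k, Subtype.ext hk⟩
    · congr 1
      funext i
      refine hrest _ _ _ _ ?_
      rintro ⟨k, hk⟩
      exact k.1.2 k.2 (by rw [show pos (k.1.1, k.2) = i from hk]; exact i.2)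
  have hsum : ∑ x, ‖hdot (φ x) (codeState pos s)‖ * ‖hdot (φ x) (codeState pos t)‖ =
      ∑ p, ‖hdot (φ' p) (fun p => u s p.1 * v s p.2)‖ *
        ‖hdot (φ' p) (fun p => u t p.1 * v t p.2)‖ := by
    rw [← e.symm.sum_comp]
    refine Finset.sum_congr rfl fun p _ => ?_
    rw [← hsplit, ← hsplit, hdot_equiv e.symm (φ (e.symm p)), hdot_equiv e.symm (φ (e.symm p))]
  rw [hsum]
  refine (sum_overlap_le_of_adaptive hφ' hA hAG (u s) (u t) (hv s) (hv t)).trans ?_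
  rw [sum_overlap_pi a (fun b : U => blockState (s b.1)) (fun b : U => blockState (t b.1))]
  have hfac : ∀ b : U, ∑ c, ‖hdot (a b c) (blockState (s b.1))‖ *
      ‖hdot (a b c) (blockState (t b.1))‖ ≤ if s b.1 ≠ t b.1 then (1 - 1 / 30000 : ℝ) else 1 :=
    fun b => blockState_overlap_le (hqU b) _ _
  refine (Finset.prod_le_prod (fun b _ => Finset.sum_nonneg fun c _ => by positivity)
    fun b _ => hfac b).trans ?_
  have hcard : hammingDist s t - ℓ ≤
      (Finset.univ.filter fun b => (∀ j, pos (b, j) ∉ S) ∧ s b ≠ t b).card := by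
    have h1 := card_touched_le hpos S
    have h2 : hammingDist s t ≤
        (Finset.univ.filter fun b => (∀ j, pos (b, j) ∉ S) ∧ s b ≠ t b).card +
        (Finset.univ.filter fun b => ¬ ∀ j, pos (b, j) ∉ S).card := by
      refine le_trans (Finset.card_le_card ?_) (Finset.card_union_le _ _)
      intro b hb
      simp only [Finset.mem_filter, Finset.mem_univ, true_and, Finset.mem_union] at hb ⊢
      tauto
    omega
  have hprod : ∏ b : U, (if s b.1 ≠ t b.1 then (1 - 1 / 30000 : ℝ) else 1) =
      (1 - 1 / 30000 : ℝ) ^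
        (Finset.univ.filter fun b => (∀ j, pos (b, j) ∉ S) ∧ s b ≠ t b).card := by
    rw [← Finset.prod_subtype (Finset.univ.filter fun b => ∀ j, pos (b, j) ∉ S)
      (fun b => by simp) (fun b => if s b ≠ t b then (1 - 1 / 30000 : ℝ) else 1),
      ← Finset.prod_filter, Finset.filter_filter, Finset.prod_const]
  rw [hprod]
  exact pow_le_pow_of_le_one (by norm_num) (by norm_num) hcard

lemma hdot_mul_sum {I X : Type*} [Fintype X] [Fintype I] (u : X → ℂ) (c : ℂ) (Ψ : I → X → ℂ) :
    hdot u (fun y => c * ∑ s, Ψ s y) = c * ∑ s, hdot u (Ψ s) := by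
  simp only [hdot, Finset.mul_sum]
  rw [Finset.sum_comm]
  exact Finset.sum_congr rfl fun _ _ => Finset.sum_congr rfl fun _ _ => by ring

lemma norm_sq_sqrt_inv (N : ℕ) : ‖(Real.sqrt N : ℂ)⁻¹‖ ^ 2 = 1 / N := by
  rw [norm_inv, Complex.norm_real, Real.norm_eq_abs, inv_pow, sq_abs,
    Real.sq_sqrt (by positivity), one_div]

/-- The uniform superposition of orthonormal vectors whose outcome distributions pairwise barely
overlap is close to the uniform mixture. -/
lemma sum_abs_superposition_sub_mixture_le {X : Type*} [Fintype X] {N : ℕ} (hN : 0 < N)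
    (φ : X → X → ℂ) (Ψ : Fin N → X → ℂ) {δ : ℝ}
    (hδ : ∀ s t, s ≠ t → ∑ x, ‖hdot (φ x) (Ψ s)‖ * ‖hdot (φ x) (Ψ t)‖ ≤ δ) (hδ0 : 0 ≤ δ) :
    ∑ x, |‖hdot (φ x) (fun y => (Real.sqrt N : ℂ)⁻¹ * ∑ s, Ψ s y)‖ ^ 2 -
      (1 / (N : ℝ)) * ∑ s, ‖hdot (φ x) (Ψ s)‖ ^ 2| ≤ N * δ := by
  have hN' : (0 : ℝ) < N := by exact_mod_cast hN
  have hbound : ∀ c : Fin N → ℂ, |‖∑ s, c s‖ ^ 2 - ∑ s, ‖c s‖ ^ 2| ≤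
      ∑ s, ∑ t, if s = t then 0 else ‖c s‖ * ‖c t‖ := by
    intro c
    have h1 : ((‖∑ s, c s‖ ^ 2 - ∑ s, ‖c s‖ ^ 2 : ℝ) : ℂ) =
        ∑ s, ∑ t, if s = t then 0 else conj (c s) * c t := by
      have h2 : ∀ s t, (if s = t then 0 else conj (c s) * c t) =
          conj (c s) * c t - if s = t then conj (c s) * c t else 0 := by
        intro s t
        split_ifs <;> simp
      simp only [h2, Finset.sum_sub_distrib, Finset.sum_ite_eq, Finset.mem_univ, if_true,
        ← Finset.sum_mul_sum, Complex.conj_mul', ← map_sum]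
      push_cast
      rfl
    rw [← Real.norm_eq_abs, ← Complex.norm_real, h1]
    refine (norm_sum_le _ _).trans (Finset.sum_le_sum fun s _ => (norm_sum_le _ _).trans
      (Finset.sum_le_sum fun t _ => ?_))
    split_ifs <;> simp
  calc _ ≤ ∑ x, (1 / (N : ℝ)) * ∑ s, ∑ t,
        if s = t then 0 else ‖hdot (φ x) (Ψ s)‖ * ‖hdot (φ x) (Ψ t)‖ := by
        refine Finset.sum_le_sum fun x _ => ?_
        rw [hdot_mul_sum, norm_mul, mul_pow, norm_sq_sqrt_inv, ← mul_sub, abs_mul, abs_of_pos (by positivity)]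
        gcongr
        exact hbound _
    _ = (1 / (N : ℝ)) * ∑ s, ∑ t, ∑ x,
        if s = t then 0 else ‖hdot (φ x) (Ψ s)‖ * ‖hdot (φ x) (Ψ t)‖ := by
        rw [← Finset.mul_sum, Finset.sum_comm]
        congr 1
        exact Finset.sum_congr rfl fun s _ => Finset.sum_comm
    _ ≤ (1 / (N : ℝ)) * ∑ _s : Fin N, ∑ _t : Fin N, δ := by
        gcongr with s _ t _
        split_ifs with h
        · simpa using hδ0
        · exact hδ s t h
    _ = N * δ := by
        simp
        field_simp

lemma NN_bounds (n : ℕ) : 1 ≤ NN n ∧ (NN n : ℝ) ≤ 2 ^ ((n : ℝ) / 10 ^ 10) ∧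
    (2 : ℝ) ^ ((n : ℝ) / 10 ^ 10) ≤ 2 * NN n := by
  have he : (10 : ℝ) ^ (-10 : ℝ) * n = (n : ℝ) / 10 ^ 10 := by
    rw [Real.rpow_neg (by norm_num), div_eq_inv_mul]
    norm_cast
  have h1 : (1 : ℝ) ≤ 2 ^ ((n : ℝ) / 10 ^ 10) := Real.one_le_rpow (by norm_num) (by positivity)
  have h2 : 1 ≤ NN n := by
    rw [NN, he]
    exact Nat.le_floor (by simpa using h1)
  have h3 : (2 : ℝ) ^ ((n : ℝ) / 10 ^ 10) < NN n + 1 := by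
    rw [NN, he]
    exact Nat.lt_floor_add_one _
  have h4 : (1 : ℝ) ≤ NN n := by exact_mod_cast h2
  refine ⟨h2, ?_, by linarith⟩
  rw [NN, he]
  exact Nat.floor_le (by positivity)

lemma exists_code_of_large {n : ℕ} (hn : 10 ^ 12 ≤ n) :
    ∃ s : Fin (NN n) → Fin (5 * (n / 15)) → Fin 2,
      ∀ i j, i ≠ j → n / 15 ≤ hammingDist (s i) (s j) := by
  refine exists_code _ _ _ ?_
  set d := n / 15 with hd
  have hN : (NN n : ℝ) < 2 ^ d := by
    refine (NN_bounds n).2.1.trans_lt ?_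
    rw [← Real.rpow_natCast 2 d]
    refine Real.rpow_lt_rpow_of_exponent_lt (by norm_num) ?_
    have h1 : n < 15 * (d + 1) := by omega
    have h2 : (n : ℝ) < 15 * (d + 1) := by exact_mod_cast h1
    have h3 : (1000000000000 : ℝ) ≤ n := by
      norm_num at hn
      exact_mod_cast hn
    rw [div_lt_iff₀ (by positivity)]
    norm_num
    linarith
  rw [pow_mul, pow_mul]
  calc (NN n : ℝ) * (((3 / 2) ^ 5) ^ d * 2 ^ d)
      < 2 ^ d * (((3 / 2) ^ 5) ^ d * 2 ^ d) := by gcongr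
    _ = (2 * ((3 / 2) ^ 5 * 2)) ^ d := by rw [mul_pow, mul_pow]
    _ ≤ (2 ^ 5) ^ d := by gcongr; norm_num

lemma overlap_pow_le {n : ℕ} (hn : 10 ^ 12 ≤ n) {h : ℕ} (hh : n / 15 ≤ h) :
    (NN n : ℝ) * (1 - 1 / 30000 : ℝ) ^ (h - Nat.floor ((10 : ℝ) ^ (-8 : ℝ) * n)) ≤
      2 ^ (-(1 / 10 ^ 11 * n : ℝ)) := by
  set ℓ := Nat.floor ((10 : ℝ) ^ (-8 : ℝ) * n) with hℓ
  have he : (10 : ℝ) ^ (-8 : ℝ) * n = (n : ℝ) / 10 ^ 8 := by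
    rw [Real.rpow_neg (by norm_num), div_eq_inv_mul]
    norm_cast
  have hℓ' : (ℓ : ℝ) ≤ n / 10 ^ 8 := by
    rw [hℓ, he]
    exact Nat.floor_le (by positivity)
  have h1 : n < 15 * (h + 1) := by omega
  have h2 : (n : ℝ) < 15 * (h + 1) := by exact_mod_cast h1
  have h3 : (1000000000000 : ℝ) ≤ n := by
    norm_num at hn
    exact_mod_cast hn
  have hk : (n : ℝ) / 20 ≤ ((h - ℓ : ℕ) : ℝ) := by
    have : (h : ℝ) ≤ ((h - ℓ : ℕ) : ℝ) + ℓ := by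
      exact_mod_cast (by omega : h ≤ h - ℓ + ℓ)
    norm_num at hℓ' ⊢
    linarith
  have hb : (1 - 1 / 30000 : ℝ) ≤ 2 ^ (-(1 / 30000) : ℝ) := by
    have e1 : (1 - 1 / 30000 : ℝ) ≤ Real.exp (-(1 / 30000)) := by
      have := Real.add_one_le_exp (-(1 / 30000) : ℝ)
      linarith
    refine e1.trans ?_
    rw [Real.rpow_def_of_pos (by norm_num)]
    refine Real.exp_le_exp.mpr ?_
    have := Real.log_two_lt_d9
    linarith
  calc (NN n : ℝ) * (1 - 1 / 30000 : ℝ) ^ (h - ℓ)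
      ≤ 2 ^ ((n : ℝ) / 10 ^ 10) * (2 ^ (-(1 / 30000) : ℝ)) ^ (h - ℓ) := by
        gcongr
        exact (NN_bounds n).2.1
    _ = 2 ^ ((n : ℝ) / 10 ^ 10 + -(1 / 30000) * ((h - ℓ : ℕ) : ℝ)) := by
        rw [← Real.rpow_mul_natCast (by norm_num), Real.rpow_add (by norm_num)]
    _ ≤ _ := by
        refine Real.rpow_le_rpow_of_exponent_le (by norm_num) ?_
        norm_num
        linarith

/-- there are a constant c > 0 and, for each large n, a pure target state ψ
and unit states ψ¹,…,ψ^N (defining the mixture ρ = (1/N)·Σ_s ψ^s(ψ^s)†) such that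
(i) ⟨ψ,ρψ⟩ = (1/N)·Σ_s |⟨ψ^s,ψ⟩|² ≤ 2^{−cn}, and (ii) for every ⌊10⁻⁸n⌋-adaptive
orthonormal basis (φ_x), Σ_x ||⟨φ_x,ψ⟩|² − ⟨φ_x,ρφ_x⟩| ≤ 2^{−cn}. -/
theorem stmt_17 :
    ∃ c : ℝ, 0 < c ∧ ∃ n₀ : ℕ, ∀ n : ℕ, n₀ ≤ n →
      ∃ (ψ : (Fin n → Fin 2) → ℂ) (ψs : Fin (NN n) → (Fin n → Fin 2) → ℂ),
        (∑ y, ‖ψ y‖ ^ 2 = 1) ∧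
        (∀ s, ∑ y, ‖ψs s y‖ ^ 2 = 1) ∧
        ((1 / (NN n : ℝ)) * ∑ s, ‖∑ y, conj (ψs s y) * ψ y‖ ^ 2 ≤
          (2 : ℝ) ^ (-(c * n))) ∧
        (∀ φ : (Fin n → Fin 2) → (Fin n → Fin 2) → ℂ,
          IsAdaptiveBasis n (Nat.floor ((10 : ℝ) ^ (-8 : ℝ) * n)) φ →
          ∑ x, |‖∑ y, conj (φ x y) * ψ y‖ ^ 2
              - (1 / (NN n : ℝ)) * ∑ s, ‖∑ y, conj (φ x y) * ψs s y‖ ^ 2| ≤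
            (2 : ℝ) ^ (-(c * n))) := by
  refine ⟨1 / 10 ^ 11, by norm_num, 10 ^ 12, fun n hn => ?_⟩
  obtain ⟨code, hcode⟩ := exists_code_of_large hn
  obtain ⟨hN1, -, hN2⟩ := NN_bounds n
  have hN0 : (0 : ℝ) < NN n := by exact_mod_cast hN1
  let pos : Fin (5 * (n / 15)) × Fin 3 → Fin n := fun k => ⟨3 * k.1 + k.2, by omega⟩
  have hpos : Function.Injective pos := by
    rintro ⟨b, j⟩ ⟨b', j'⟩ h
    have h' : 3 * (b : ℕ) + j = 3 * b' + j' := congrArg Fin.val h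
    rw [Prod.mk.injEq]
    exact ⟨Fin.ext (by omega), Fin.ext (by omega)⟩
  have hd : 0 < n / 15 := by omega
  have hinj : Function.Injective code := by
    intro s t hst
    by_contra hne
    have := hcode s t hne
    rw [hst, hammingDist_self] at this
    omega
  let Ψ : Fin (NN n) → (Fin n → Fin 2) → ℂ := fun s => codeState pos (code s)
  have hΨ : ∀ s t, hdot (Ψ s) (Ψ t) = if s = t then 1 else 0 := fun s t =>
    (isOrthoFamily_codeState hpos _ _).trans (ite_one_zero_congr hinj.eq_iff)
  let ψ : (Fin n → Fin 2) → ℂ := fun y => (Real.sqrt (NN n) : ℂ)⁻¹ * ∑ s, Ψ s y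
  have hψ : ∀ u, hdot u ψ = (Real.sqrt (NN n) : ℂ)⁻¹ * ∑ s, hdot u (Ψ s) :=
    fun u => hdot_mul_sum u _ Ψ
  have hΨψ : ∀ s, ‖hdot (Ψ s) ψ‖ ^ 2 = 1 / NN n := by
    intro s
    simp only [hψ, hΨ, Finset.sum_ite_eq, Finset.mem_univ, if_true, mul_one]
    exact norm_sq_sqrt_inv _
  refine ⟨ψ, Ψ, ?_, fun s => (isOrthoFamily_codeState hpos).sum_norm_sq _, ?_, ?_⟩
  · have h1 : ∀ s, hdot ψ (Ψ s) = (Real.sqrt (NN n) : ℂ)⁻¹ := by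
      intro s
      have : hdot ψ (Ψ s) = conj (hdot (Ψ s) ψ) := by simp [hdot, mul_comm]
      rw [this, hψ]
      simp [hΨ]
    have h2 := hdot_self ψ
    rw [hψ ψ] at h2
    simp only [h1, Finset.sum_const, Finset.card_univ, Fintype.card_fin, nsmul_eq_mul] at h2
    have h3 : (Real.sqrt (NN n) : ℂ)⁻¹ * (NN n * (Real.sqrt (NN n) : ℂ)⁻¹) = 1 := by
      have h4 : Real.sqrt (NN n) ≠ 0 := (Real.sqrt_pos.mpr hN0).ne'
      have h5 : (Real.sqrt (NN n))⁻¹ * (NN n * (Real.sqrt (NN n))⁻¹) = 1 := by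
        field_simp
        exact (Real.sq_sqrt hN0.le).symm
      exact_mod_cast h5
    rw [h3] at h2
    exact_mod_cast h2.symm
  · have h1 : (1 / (NN n : ℝ)) * ∑ s, ‖hdot (Ψ s) ψ‖ ^ 2 = 1 / NN n := by
      simp only [hΨψ, Finset.sum_const, Finset.card_univ, Fintype.card_fin, nsmul_eq_mul]
      field_simp
    refine h1.trans_le ?_
    rw [Real.rpow_neg (by norm_num), one_div]
    refine inv_anti₀ (by positivity) ?_
    have h3 : (1000000000000 : ℝ) ≤ n := by
      norm_num at hn
      exact_mod_cast hn
    have h4 : (2 : ℝ) ^ (1 / 10 ^ 11 * n : ℝ) * 2 ≤ 2 ^ ((n : ℝ) / 10 ^ 10) := by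
      rw [← Real.rpow_add_one (by norm_num)]
      refine Real.rpow_le_rpow_of_exponent_le (by norm_num) ?_
      norm_num
      linarith
    linarith
  · intro φ hφ
    have hdist : ∀ s t, s ≠ t → ∑ x, ‖hdot (φ x) (Ψ s)‖ * ‖hdot (φ x) (Ψ t)‖ ≤
        2 ^ (-(1 / 10 ^ 11 * n : ℝ)) / NN n := by
      intro s t hst
      refine (codeState_overlap_le hpos hφ (code s) (code t)).trans ?_
      rw [le_div_iff₀' hN0]
      exact overlap_pow_le hn (hcode s t hst)
    refine (sum_abs_superposition_sub_mixture_le hN1 φ Ψ hdist (by positivity)).trans_eq ?_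
    field_simp
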